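/- For every (m,k) ∈ ℕ⋊ℕ^× and every (r,a) ∈ N̄ × Ẑ, the collection of nonempty hereditary directed subsets of ℕ⋊ℕ^× containing {(m+kn, kl) : (n,l) ∈ p(r,a)} has a smallest element with respect to inclusion, and this smallest element equals p(m+kr, ka), where m+kr is computed in ℕ if r ∈ ℕ and in the ring Ẑ if r ∈ Ẑ. In other words, the Nica action of ℕ⋊ℕ^× on Ω corresponds under p to the action (m,k)(r,a) = (m+kr, ka). -/

import Mathlib

open scoped Classical

instance (p : Nat.Primes) : Fact (Nat.Prime (p : ℕ)) := ⟨p.2⟩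

/-- `Ẑ = ∏_p ℤ_p`. -/
abbrev Zhat : Type := Π p : Nat.Primes, ℤ_[(p : ℕ)]

/-- Elements of the semigroup `ℕ ⋊ ℕ^×`. -/
abbrev NxN : Type := ℕ × ℕ+

/-- The semigroup operation `(m,k)(n,l) = (m + k n, k l)`. -/
def nmul (x y : NxN) : NxN := (x.1 + (x.2 : ℕ) * y.1, x.2 * y.2)

/-- `x ≤ y` iff `y ∈ x (ℕ ⋊ ℕ^×)`. -/
def nle (x y : NxN) : Prop := ∃ z : NxN, y = nmul x z

def Hereditary (ω : Set NxN) : Prop := ∀ x y : NxN, y ∈ ω → nle x y → x ∈ ω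

def DirectedSet (ω : Set NxN) : Prop := ∀ x ∈ ω, ∀ y ∈ ω, ∃ z ∈ ω, nle x z ∧ nle y z

/-- A nonempty hereditary directed subset of `ℕ ⋊ ℕ^×`. -/
def IsNica (ω : Set NxN) : Prop := ω.Nonempty ∧ Hereditary ω ∧ DirectedSet ω

/-- The Nica spectrum. -/
def Omega : Type := {ω : Set NxN // IsNica ω}

/-- `a ∈ kẐ`. -/
def inK (a : Zhat) (k : ℕ) : Prop := ∃ z : Zhat, a = (k : Zhat) * z

/-- The type A sets. -/
def Aset (r : ℕ) (a : Zhat) : Set NxN :=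
  {x | inK a (x.2 : ℕ) ∧ x.1 ≤ r ∧ (x.2 : ℕ) ∣ (r - x.1)}

/-- The type B sets. -/
def Bset (r : Zhat) (a : Zhat) : Set NxN :=
  {x | inK a (x.2 : ℕ) ∧ ∃ z : Zhat, r - (x.1 : Zhat) = ((x.2 : ℕ) : Zhat) * z}

/-- `N̄ = ℕ ⊔ Ẑ`. -/
abbrev NBar : Type := ℕ ⊕ Zhat

/-- The parametrization map, as a map into subsets of `ℕ ⋊ ℕ^×`. -/
def pset : NBar × Zhat → Set NxN
  | (Sum.inl r, a) => Aset r a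
  | (Sum.inr r, a) => Bset r a

/-- The action of `(m,k) ∈ ℕ ⋊ ℕ^×` on `N̄`: `r ↦ m + k r`, computed in `ℕ` on the `ℕ` part
and in the ring `Ẑ` on the `Ẑ` part. -/
noncomputable def nact (m : ℕ) (k : ℕ+) : NBar → NBar
  | Sum.inl n => Sum.inl (m + (k : ℕ) * n)
  | Sum.inr r => Sum.inr ((m : Zhat) + ((k : ℕ) : Zhat) * r)

theorem mem_Aset {r : ℕ} {a : Zhat} {x : NxN} :
    x ∈ Aset r a ↔ ((x.2 : ℕ) : Zhat) ∣ a ∧ x.1 ≤ r ∧ (x.2 : ℕ) ∣ r - x.1 := Iff.rfl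

theorem mem_Bset {r a : Zhat} {x : NxN} :
    x ∈ Bset r a ↔ ((x.2 : ℕ) : Zhat) ∣ a ∧ ((x.2 : ℕ) : Zhat) ∣ r - (x.1 : Zhat) := Iff.rfl

theorem nle_iff {x y : NxN} :
    nle x y ↔ (x.1 ≤ y.1 ∧ (x.2 : ℕ) ∣ y.1 - x.1) ∧ (x.2 : ℕ) ∣ (y.2 : ℕ) := by
  constructor
  · rintro ⟨z, rfl⟩
    simp [nmul]
  · rintro ⟨⟨hle, n, hn⟩, hd⟩
    obtain ⟨l, hl⟩ := PNat.dvd_iff.2 hd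
    exact ⟨(n, l), Prod.ext (by simp only [nmul]; omega) hl⟩

/-- In a commutative ring, the ideal generated by `lcm k l` contains every common multiple
of the natural numbers `k` and `l`. -/
theorem natCast_lcm_dvd {R : Type*} [CommRing R] {a : R} {k l : ℕ} (hk : k ≠ 0)
    (h₁ : (k : R) ∣ a) (h₂ : (l : R) ∣ a) : ((Nat.lcm k l : ℕ) : R) ∣ a := by
  obtain ⟨g, k', l', hg, hco, rfl, rfl⟩ :=
    Nat.exists_coprime' (m := k) (n := l) (Nat.gcd_pos_of_pos_left l (Nat.pos_of_ne_zero hk))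
  have hlcm : Nat.lcm (k' * g) (l' * g) = k' * l' * g := by
    rw [Nat.lcm_mul_right, hco.lcm_eq_mul]
  obtain ⟨z, hz⟩ := h₁
  obtain ⟨w, hw⟩ := h₂
  obtain ⟨u, v, huv⟩ := Nat.isCoprime_iff_coprime.2 hco
  have huv' : (u : R) * k' + v * l' = 1 := by exact_mod_cast congrArg (Int.cast : ℤ → R) huv
  refine ⟨u * w + v * z, ?_⟩
  rw [hlcm]
  push_cast at hz hw ⊢
  linear_combination (-a) * huv' + u * k' * hw + v * l' * hz

theorem Zhat.dvd_iff {a b : Zhat} : a ∣ b ↔ ∀ p, a p ∣ b p := by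
  constructor
  · rintro ⟨z, rfl⟩ p
    exact ⟨z p, rfl⟩
  · intro h
    choose z hz using h
    exact ⟨z, funext hz⟩

theorem Zhat.natCast_dvd_natCast {l n : ℕ} : (l : Zhat) ∣ (n : Zhat) ↔ l ∣ n := by
  refine ⟨fun h ↦ ?_, Nat.cast_dvd_cast⟩
  rw [Nat.dvd_iff_prime_pow_dvd_dvd]
  intro p e hp he
  obtain ⟨p, rfl⟩ : ∃ p' : Nat.Primes, (p' : ℕ) = p := ⟨⟨p, hp⟩, rfl⟩
  have h' : (((p : ℕ) ^ e : ℕ) : ℤ_[(p : ℕ)]) ∣ (n : ℕ) :=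
    (Nat.cast_dvd_cast he).trans (Zhat.dvd_iff.1 h p)
  exact_mod_cast (PadicInt.pow_p_dvd_int_iff (p := (p : ℕ)) e n).1 (by exact_mod_cast h')

theorem Zhat.natCast_mul_left_cancel {k : ℕ} (hk : k ≠ 0) {a b : Zhat}
    (h : (k : Zhat) * a = k * b) : a = b := by
  funext p
  exact mul_left_cancel₀ (Nat.cast_ne_zero.2 hk : (k : ℤ_[(p : ℕ)]) ≠ 0) (congrFun h p)

theorem Zhat.exists_prime_dvd_sub_natCast (q : Nat.Primes) (r : Zhat) :
    ∃ s : ℕ, ((q : ℕ) : Zhat) ∣ r - (s : Zhat) := by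
  refine ⟨(r q).zmodRepr, Zhat.dvd_iff.2 fun p ↦ ?_⟩
  by_cases hp : p = q
  · subst hp
    have := PadicInt.sub_zmodRepr_mem (r p)
    rwa [PadicInt.maximalIdeal_eq_span_p, Ideal.mem_span_singleton] at this
  · have hu : IsUnit ((q : ℕ) : ℤ_[(p : ℕ)]) := by
      rw [PadicInt.isUnit_iff, PadicInt.norm_natCast_eq_one_iff, Nat.coprime_primes p.2 q.2]
      exact fun h ↦ hp (Subtype.ext h)
    exact hu.dvd

/-- `ℕ` is dense in `Ẑ`. -/
theorem Zhat.exists_dvd_sub_natCast {L : ℕ} (hL : L ≠ 0) (r : Zhat) :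
    ∃ s : ℕ, (L : Zhat) ∣ r - (s : Zhat) := by
  induction L using induction_on_primes generalizing r with
  | zero => exact absurd rfl hL
  | one => exact ⟨0, by simp⟩
  | prime_mul q M hq ih =>
    obtain ⟨s, z, hz⟩ := ih (right_ne_zero_of_mul hL) r
    obtain ⟨t, w, hw⟩ := Zhat.exists_prime_dvd_sub_natCast ⟨q, hq⟩ z
    refine ⟨s + M * t, w, ?_⟩
    push_cast
    linear_combination hz + M * hw

theorem Zhat.exists_ge_dvd_sub_natCast {L : ℕ} (hL : L ≠ 0) (r : Zhat) (N : ℕ) :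
    ∃ s : ℕ, N ≤ s ∧ (L : Zhat) ∣ r - (s : Zhat) := by
  obtain ⟨s, z, hz⟩ := Zhat.exists_dvd_sub_natCast hL r
  refine ⟨s + L * N, ?_, z - N, ?_⟩
  · nlinarith [Nat.pos_of_ne_zero hL]
  · push_cast
    linear_combination hz

theorem le_and_dvd_sub_of_Zhat {m n l : ℕ} {r : Zhat} (hmn : m ≤ n)
    (hm : (l : Zhat) ∣ r - (m : Zhat)) (hn : (l : Zhat) ∣ r - (n : Zhat)) :
    m ≤ n ∧ l ∣ n - m := by
  refine ⟨hmn, Zhat.natCast_dvd_natCast.1 ?_⟩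
  rw [Nat.cast_sub hmn]
  simpa using dvd_sub hm hn

theorem isNica_Aset (r : ℕ) (a : Zhat) : IsNica (Aset r a) := by
  refine ⟨⟨(0, 1), by simp [mem_Aset]⟩, fun x y hy hxy ↦ ?_, fun x hx y hy ↦ ?_⟩
  · rw [mem_Aset] at hy ⊢
    obtain ⟨⟨hle, hd⟩, hd'⟩ := nle_iff.1 hxy
    obtain ⟨ha, hr, hrd⟩ := hy
    refine ⟨(Nat.cast_dvd_cast hd').trans ha, hle.trans hr, ?_⟩
    rw [← Nat.sub_add_sub_cancel hr hle]
    exact dvd_add (hd'.trans hrd) hd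
  · rw [mem_Aset] at hx hy
    refine ⟨(r, PNat.lcm x.2 y.2), ?_, ?_, ?_⟩
    · simpa [mem_Aset] using natCast_lcm_dvd x.2.ne_zero hx.1 hy.1
    · exact nle_iff.2 ⟨hx.2, by simpa using Nat.dvd_lcm_left _ _⟩
    · exact nle_iff.2 ⟨hy.2, by simpa using Nat.dvd_lcm_right _ _⟩

theorem isNica_Bset (r a : Zhat) : IsNica (Bset r a) := by
  refine ⟨⟨(0, 1), by simp [mem_Bset]⟩, fun x y hy hxy ↦ ?_, fun x hx y hy ↦ ?_⟩
  · rw [mem_Bset] at hy ⊢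
    obtain ⟨⟨hle, hd⟩, hd'⟩ := nle_iff.1 hxy
    refine ⟨(Nat.cast_dvd_cast hd').trans hy.1, ?_⟩
    have h : ((x.2 : ℕ) : Zhat) ∣ ((y.1 - x.1 : ℕ) : Zhat) := Nat.cast_dvd_cast hd
    rw [Nat.cast_sub hle] at h
    simpa using dvd_add ((Nat.cast_dvd_cast hd').trans hy.2) h
  · rw [mem_Bset] at hx hy
    obtain ⟨s, hs, hd⟩ := Zhat.exists_ge_dvd_sub_natCast
      (Nat.lcm_ne_zero x.2.ne_zero y.2.ne_zero) r (max x.1 y.1)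
    have h₁ := Nat.dvd_lcm_left (x.2 : ℕ) y.2
    have h₂ := Nat.dvd_lcm_right (x.2 : ℕ) y.2
    refine ⟨(s, PNat.lcm x.2 y.2), ?_, ?_, ?_⟩
    · rw [mem_Bset, PNat.lcm_coe]
      exact ⟨natCast_lcm_dvd x.2.ne_zero hx.1 hy.1, hd⟩
    · exact nle_iff.2 ⟨le_and_dvd_sub_of_Zhat ((le_max_left _ _).trans hs) hx.2
        ((Nat.cast_dvd_cast h₁).trans hd), by simpa using h₁⟩
    · exact nle_iff.2 ⟨le_and_dvd_sub_of_Zhat ((le_max_right _ _).trans hs) hy.2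
        ((Nat.cast_dvd_cast h₂).trans hd), by simpa using h₂⟩

/-- If `ka ∈ lẐ`, then some `l'` has `a ∈ l'Ẑ` and `l ∣ k l'`. -/
theorem exists_dvd_of_dvd_mul {k l : ℕ+} {a : Zhat}
    (h : ((l : ℕ) : Zhat) ∣ ((k : ℕ) : Zhat) * a) :
    ∃ l' : ℕ+, ((l' : ℕ) : Zhat) ∣ a ∧ (l : ℕ) ∣ (k : ℕ) * l' := by
  obtain ⟨l', hl'⟩ := PNat.dvd_lcm_left k l
  have hcoe : Nat.lcm k l = (k : ℕ) * l' := by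
    rw [← PNat.lcm_coe, hl', PNat.mul_coe]
  refine ⟨l', ?_, hcoe ▸ Nat.dvd_lcm_right _ _⟩
  obtain ⟨z, hz⟩ := natCast_lcm_dvd k.ne_zero (Dvd.intro a rfl) h
  refine ⟨z, Zhat.natCast_mul_left_cancel k.ne_zero ?_⟩
  rw [hz, hcoe, Nat.cast_mul, mul_assoc]

theorem isNica_pset (x : NBar × Zhat) : IsNica (pset x) := by
  obtain ⟨r | r, a⟩ := x
  exacts [isNica_Aset r a, isNica_Bset r a]

theorem nmul_mem_pset {m : ℕ} {k : ℕ+} {r : NBar} {a : Zhat} {x : NxN} (hx : x ∈ pset (r, a)) :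
    nmul (m, k) x ∈ pset (nact m k r, ((k : ℕ) : Zhat) * a) := by
  obtain r | r := r
  · obtain ⟨ha, hr, hd⟩ := mem_Aset.1 hx
    refine mem_Aset.2 ⟨?_, ?_, ?_⟩
    · simpa [nmul] using mul_dvd_mul_left _ ha
    · simpa [nmul] using hr
    · simpa [nmul, Nat.add_sub_add_left, ← Nat.mul_sub] using mul_dvd_mul_left (k : ℕ) hd
  · obtain ⟨ha, hd⟩ := mem_Bset.1 hx
    refine mem_Bset.2 ⟨?_, ?_⟩
    · simpa [nmul] using mul_dvd_mul_left _ ha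
    · simpa [nmul, mul_sub] using mul_dvd_mul_left ((k : ℕ) : Zhat) hd

theorem exists_nle_nmul {m : ℕ} {k : ℕ+} {r : NBar} {a : Zhat} {y : NxN}
    (hy : y ∈ pset (nact m k r, ((k : ℕ) : Zhat) * a)) :
    ∃ x ∈ pset (r, a), nle y (nmul (m, k) x) := by
  obtain r | r := r
  · obtain ⟨ha, hr⟩ := mem_Aset.1 hy
    obtain ⟨l', hl', hd⟩ := exists_dvd_of_dvd_mul ha
    exact ⟨(r, l'), mem_Aset.2 ⟨hl', by simp⟩, nle_iff.2 ⟨hr, by simpa [nmul] using hd⟩⟩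
  · obtain ⟨ha, hr⟩ := mem_Bset.1 hy
    obtain ⟨l', hl', hd⟩ := exists_dvd_of_dvd_mul ha
    obtain ⟨n, hn, hrn⟩ := Zhat.exists_ge_dvd_sub_natCast l'.ne_zero r y.1
    refine ⟨(n, l'), mem_Bset.2 ⟨hl', hrn⟩, nle_iff.2 ⟨?_, by simpa [nmul] using hd⟩⟩
    refine le_and_dvd_sub_of_Zhat ?_ hr ((Nat.cast_dvd_cast hd).trans ?_)
    · simp only [nmul]
      nlinarith [k.pos]
    · simpa [nmul, mul_sub] using mul_dvd_mul_left ((k : ℕ) : Zhat) hrn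

/-- For every `(m,k) ∈ ℕ ⋊ ℕ^×` and `(r,a) ∈ N̄ × Ẑ`, the collection of nonempty hereditary
directed subsets of `ℕ ⋊ ℕ^×` containing `{(m + kn, kl) : (n,l) ∈ p(r,a)}` has a smallest
element with respect to inclusion, namely `p(m + kr, ka)`.  That is, the Nica action of
`ℕ ⋊ ℕ^×` on `Ω` corresponds under `p` to `(m,k)(r,a) = (m + kr, ka)`. -/
theorem nica_action_eq (m : ℕ) (k : ℕ+) (r : NBar) (a : Zhat) :
    IsLeast {t : Set NxN | IsNica t ∧ nmul (m, k) '' pset (r, a) ⊆ t}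
      (pset (nact m k r, ((k : ℕ) : Zhat) * a)) := by
  refine ⟨⟨isNica_pset _, Set.image_subset_iff.2 fun x hx ↦ nmul_mem_pset hx⟩, ?_⟩
  rintro t ⟨⟨-, hher, -⟩, ht⟩ y hy
  obtain ⟨x, hx, hyx⟩ := exists_nle_nmul hy
  exact hher y _ (ht ⟨x, hx, rfl⟩) hyx
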